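/- Let X be an irreducible, aperiodic, stationary first-order Markov chain on the finite alphabet 𝒳, g: 𝒳 → 𝒴, and Y_n := g(X_n). Then Δ_P^∞(X, g) := lim_{k→∞} Δ_P^k(X, g) = R̄(X) − R̄(Y) ≥ Δ_L^1(X, g); consequently the cost functions form an ordered chain Δ_P^1(X,g) ≥ Δ_P^2(X,g) ≥ ... ≥ Δ_P^∞(X,g) ≥ Δ_L^1(X,g) ≥ Δ_L^2(X,g) ≥ ... ≥ 0. -/

import Mathlib

open Filter

section MarkovAggregation

variable {𝒳 : Type*} {𝒴 : Type*} [Fintype 𝒳] [DecidableEq 𝒳] [Fintype 𝒴] [DecidableEq 𝒴]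

/-- Shannon entropy of a probability mass function on a finite set. -/
noncomputable def entPMF {α : Type*} [Fintype α] (p : α → ℝ) : ℝ :=
  ∑ a : α, Real.negMulLog (p a)

/-- Marginal of a joint pmf on the first component. -/
noncomputable def margFst {α β : Type*} [Fintype β] (p : α × β → ℝ) : α → ℝ :=
  fun a => ∑ b : β, p (a, b)

/-- Marginal of a joint pmf on the second component. -/
noncomputable def margSnd {α β : Type*} [Fintype α] (p : α × β → ℝ) : β → ℝ :=
  fun b => ∑ a : α, p (a, b)

/-- Conditional Shannon entropy H(A | B) of a joint pmf `p` of the pair (A, B). -/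
noncomputable def condEntPMF {α β : Type*} [Fintype α] [Fintype β] (p : α × β → ℝ) : ℝ :=
  entPMF p - entPMF (margSnd p)

/-- Mutual information I(A ; B) of a joint pmf `p` of the pair (A, B). -/
noncomputable def mutInfPMF {α β : Type*} [Fintype α] [Fintype β] (p : α × β → ℝ) : ℝ :=
  entPMF (margFst p) + entPMF (margSnd p) - entPMF p

/-- Probability that a first-order Markov chain with initial distribution `π` and transition
matrix `P` emits the path (x_0, ..., x_{n-1}). -/
noncomputable def xPath (π : 𝒳 → ℝ) (P : Matrix 𝒳 𝒳 ℝ) (n : ℕ) (x : Fin n → 𝒳) : ℝ :=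
  (if h : 0 < n then π (x ⟨0, h⟩) else 1) *
    ∏ i : Fin n, if h : i.val + 1 < n then P (x i) (x ⟨i.val + 1, h⟩) else 1

/-- Probability that the projection Y_n = g(X_n) emits the path (y_0, ..., y_{n-1}). -/
noncomputable def yPath (π : 𝒳 → ℝ) (P : Matrix 𝒳 𝒳 ℝ) (g : 𝒳 → 𝒴) (n : ℕ)
    (y : Fin n → 𝒴) : ℝ :=
  ∑ x : Fin n → 𝒳, if ∀ i, g (x i) = y i then xPath π P n x else 0

/-- Joint probability of (X_1, (Y_2, ..., Y_{m+1})). -/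
noncomputable def xyPath (π : 𝒳 → ℝ) (P : Matrix 𝒳 𝒳 ℝ) (g : 𝒳 → 𝒴) (m : ℕ)
    (x₀ : 𝒳) (y : Fin m → 𝒴) : ℝ :=
  ∑ x : Fin (m + 1) → 𝒳,
    if x 0 = x₀ ∧ ∀ i : Fin m, g (x i.succ) = y i then xPath π P (m + 1) x else 0

/-- A matrix is primitive iff some power (and all larger powers) of it is entrywise positive;
for a stochastic matrix this is equivalent to being irreducible and aperiodic. -/
def PrimitiveMatrix (P : Matrix 𝒳 𝒳 ℝ) : Prop :=
  ∃ N : ℕ, ∀ n : ℕ, N ≤ n → ∀ i j : 𝒳, 0 < (P ^ n) i j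

/-- A Markov chain with transition matrix `P` is `k`-lumpable w.r.t. `g` iff for every initial
distribution `π` the projected process is a `k`-th order Markov chain whose transition matrix `Q`
does not depend on `π`. -/
def Lumpable (P : Matrix 𝒳 𝒳 ℝ) (g : 𝒳 → 𝒴) (k : ℕ) : Prop :=
  ∃ Q : (Fin k → 𝒴) → 𝒴 → ℝ,
    ∀ π : 𝒳 → ℝ, (∀ x, 0 ≤ π x) → (∑ x, π x = 1) →
      ∀ n : ℕ, ∀ hn : k ≤ n, ∀ y : Fin n → 𝒴, ∀ j : 𝒴,
        yPath π P g (n + 1) (Fin.snoc y j) =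
          yPath π P g n y *
            Q (fun i : Fin k => y ⟨n - k + i.val, by have := i.isLt; omega⟩) j

/-- The lumpability cost Δ_L^{k+1}(X, g) = H(Y_{k+2} | Y_1^{k+1}) - H(Y_{k+2} | Y_2^{k+1}, X_1),
for the stationary chain with invariant distribution `μ` and transition matrix `P`. -/
noncomputable def lumpCost (μ : 𝒳 → ℝ) (P : Matrix 𝒳 𝒳 ℝ) (g : 𝒳 → 𝒴) (k : ℕ) : ℝ :=
  condEntPMF (fun q : 𝒴 × (Fin (k + 1) → 𝒴) => yPath μ P g (k + 2) (Fin.snoc q.2 q.1)) -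
  condEntPMF (fun q : 𝒴 × (𝒳 × (Fin k → 𝒴)) =>
    xyPath μ P g (k + 1) q.2.1 (Fin.snoc q.2.2 q.1))

/-- The predictability cost Δ_P^{k+1}(X, g) = I(X_2 ; X_1) - I(Y_{k+2} ; Y_1^{k+1}),
for the stationary chain with invariant distribution `μ` and transition matrix `P`. -/
noncomputable def predCost (μ : 𝒳 → ℝ) (P : Matrix 𝒳 𝒳 ℝ) (g : 𝒳 → 𝒴) (k : ℕ) : ℝ :=
  mutInfPMF (fun q : 𝒳 × 𝒳 => μ q.1 * P q.1 q.2) -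
  mutInfPMF (fun q : 𝒴 × (Fin (k + 1) → 𝒴) => yPath μ P g (k + 2) (Fin.snoc q.2 q.1))

/-- Path probabilities of a stationary `K`-th order Markov chain on `𝒴` with stationary
`K`-dimensional distribution `ρ` and transition matrix `R`. -/
noncomputable def mkvPath {K : ℕ} (ρ : (Fin K → 𝒴) → ℝ) (R : (Fin K → 𝒴) → 𝒴 → ℝ)
    (n : ℕ) (y : Fin n → 𝒴) : ℝ :=
  if h : K ≤ n then
    ρ (fun i => y ⟨i.val, lt_of_lt_of_le i.isLt h⟩) *
      ∏ m : Fin n, if hm : K ≤ m.val then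
        R (fun i => y ⟨m.val - K + i.val, by have h1 := i.isLt; have h2 := m.isLt; omega⟩) (y m)
      else 1
  else
    ∑ z : Fin K → 𝒴, if ∀ i : Fin n, z ⟨i.val, by have := i.isLt; omega⟩ = y i then ρ z else 0

end MarkovAggregation

section Helpers

theorem condEnt_aux (q B Q C : ℝ) (hq : 0 ≤ q) (hB : q ≤ B) (hQ : q ≤ Q) (hC : q ≤ C) :
    Real.negMulLog q + q * Real.log B + q * Real.log Q - q * Real.log C ≤ B * Q / C - q := by
  rcases hq.eq_or_lt with h | h
  · subst h
    simp
    positivity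
  · have hB' : 0 < B := h.trans_le hB
    have hQ' : 0 < Q := h.trans_le hQ
    have hC' : 0 < C := h.trans_le hC
    have h1 : Real.log (B * Q / C / q) ≤ B * Q / C / q - 1 :=
      Real.log_le_sub_one_of_pos (by positivity)
    have h2 : Real.log (B * Q / C / q) = Real.log B + Real.log Q - Real.log C - Real.log q := by
      rw [Real.log_div (by positivity) (by positivity), Real.log_div (by positivity) (by positivity),
        Real.log_mul (by positivity) (by positivity)]
    rw [h2] at h1
    have h3 := mul_le_mul_of_nonneg_left h1 hq
    have h4 : q * (B * Q / C / q - 1) = B * Q / C - q := by field_simp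
    rw [h4] at h3
    unfold Real.negMulLog
    linarith

/-- Conditioning on a function of `B` does not decrease the conditional entropy. -/
theorem condEnt_le {α β γ : Type*} [Fintype α] [Fintype β] [Fintype γ] [DecidableEq γ]
    (q : α × β → ℝ) (hq : ∀ a b, 0 ≤ q (a, b)) (u : β → γ) (Q : α × γ → ℝ)
    (hQ : ∀ a c, Q (a, c) = ∑ b, if u b = c then q (a, b) else 0) :
    condEntPMF q ≤ condEntPMF Q := by
  have hQ0 : ∀ a c, 0 ≤ Q (a, c) := fun a c => by
    rw [hQ]; exact Finset.sum_nonneg fun b _ => by split_ifs <;> simp [hq]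
  have hB : ∀ a b, q (a, b) ≤ margSnd q b := fun a b =>
    Finset.single_le_sum (f := fun a => q (a, b)) (fun a _ => hq a b) (Finset.mem_univ a)
  have hqQ : ∀ a b, q (a, b) ≤ Q (a, u b) := fun a b => by
    rw [hQ]
    have := Finset.single_le_sum (f := fun b' => if u b' = u b then q (a, b') else 0)
      (fun b' _ => by split_ifs <;> simp [hq]) (Finset.mem_univ b)
    simpa using this
  have hC : ∀ a c, Q (a, c) ≤ margSnd Q c := fun a c =>
    Finset.single_le_sum (f := fun a => Q (a, c)) (fun a _ => hQ0 a c) (Finset.mem_univ a)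
  have hmB : ∀ c, margSnd Q c = ∑ b, if u b = c then margSnd q b else 0 := by
    intro c
    simp only [margSnd, hQ]
    rw [Finset.sum_comm]
    refine Finset.sum_congr rfl fun b _ => ?_
    split_ifs <;> simp
  have key := Finset.sum_le_sum (s := (Finset.univ : Finset α)) fun a _ =>
    Finset.sum_le_sum (s := (Finset.univ : Finset β)) fun b _ =>
      condEnt_aux (q (a, b)) (margSnd q b) (Q (a, u b)) (margSnd Q (u b)) (hq a b) (hB a b)
        (hqQ a b) ((hqQ a b).trans (hC a _))
  simp only [Finset.sum_sub_distrib, Finset.sum_add_distrib] at key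
  have e1 : ∑ a, ∑ b, Real.negMulLog (q (a, b)) = entPMF q := by
    simp [entPMF, Fintype.sum_prod_type]
  have e2 : ∑ a, ∑ b, q (a, b) * Real.log (margSnd q b) = - entPMF (margSnd q) := by
    rw [Finset.sum_comm]
    simp only [← Finset.sum_mul, entPMF, Real.negMulLog, ← Finset.sum_neg_distrib]
    refine Finset.sum_congr rfl fun b _ => ?_
    simp [margSnd]
  have e3 : ∑ a, ∑ b, q (a, b) * Real.log (Q (a, u b)) = - entPMF Q := by
    simp only [entPMF, Real.negMulLog, ← Finset.sum_neg_distrib, Fintype.sum_prod_type]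
    refine Finset.sum_congr rfl fun a _ => ?_
    have : ∀ c, - (-Q (a, c) * Real.log (Q (a, c))) =
        ∑ b, if u b = c then q (a, b) * Real.log (Q (a, c)) else 0 := by
      intro c
      rw [neg_mul, neg_neg]
      nth_rewrite 1 [hQ]
      rw [Finset.sum_mul]
      refine Finset.sum_congr rfl fun b _ => ?_
      split_ifs <;> simp
    simp only [this]
    rw [Finset.sum_comm]
    simp
  have e4 : ∑ a, ∑ b, q (a, b) * Real.log (margSnd Q (u b)) = - entPMF (margSnd Q) := by
    rw [Finset.sum_comm]
    simp only [← Finset.sum_mul, entPMF, Real.negMulLog, ← Finset.sum_neg_distrib]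
    have : ∀ c, - (-margSnd Q c * Real.log (margSnd Q c)) =
        ∑ b, if u b = c then margSnd q b * Real.log (margSnd Q c) else 0 := by
      intro c
      rw [neg_mul, neg_neg]
      nth_rewrite 1 [hmB]
      rw [Finset.sum_mul]
      refine Finset.sum_congr rfl fun b _ => ?_
      split_ifs <;> simp
    simp only [this]
    rw [Finset.sum_comm]
    simp [margSnd]
  have e5 : ∑ a, ∑ b, margSnd q b * Q (a, u b) / margSnd Q (u b) ≤ ∑ a, ∑ b, q (a, b) := by
    rw [Finset.sum_comm, Finset.sum_comm (f := fun a b => q (a, b))]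
    refine Finset.sum_le_sum fun b _ => ?_
    rw [← Finset.sum_div, ← Finset.mul_sum]
    change margSnd q b * margSnd Q (u b) / margSnd Q (u b) ≤ margSnd q b
    have hb : 0 ≤ margSnd q b := Finset.sum_nonneg fun a _ => hq a b
    by_cases h : margSnd Q (u b) = 0
    · simpa [h] using hb
    · rw [mul_div_assoc, div_self h, mul_one]
  rw [e1, e2, e3, e4] at key
  unfold condEntPMF
  linarith

theorem entPMF_equiv {α β : Type*} [Fintype α] [Fintype β] (e : α ≃ β) (p : β → ℝ) :
    entPMF (fun a => p (e a)) = entPMF p :=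
  Equiv.sum_comp e fun b => Real.negMulLog (p b)

theorem ent_markov {α β γ : Type*} [Fintype α] [Fintype β] [Fintype γ]
    (K : α × β → ℝ) (W : β → γ → ℝ) (μ : β → ℝ) (hK : ∀ b, ∑ a, K (a, b) = μ b)
    (hW : ∀ b, ∑ c, W b c = 1) :
    entPMF (fun t : α × β × γ => K (t.1, t.2.1) * W t.2.1 t.2.2) + entPMF μ =
      entPMF K + entPMF (fun t : β × γ => μ t.1 * W t.1 t.2) := by
  have h1 : entPMF (fun t : α × β × γ => K (t.1, t.2.1) * W t.2.1 t.2.2) =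
      entPMF K + ∑ b, μ b * ∑ c, Real.negMulLog (W b c) := by
    simp only [entPMF, Fintype.sum_prod_type, Real.negMulLog_mul, Finset.sum_add_distrib,
      ← Finset.sum_mul, ← Finset.mul_sum, hW, one_mul, ← hK]
    congr 1
    rw [Finset.sum_comm]
    simp only [Finset.sum_mul]
  have h2 : entPMF (fun t : β × γ => μ t.1 * W t.1 t.2) =
      entPMF μ + ∑ b, μ b * ∑ c, Real.negMulLog (W b c) := by
    simp only [entPMF, Fintype.sum_prod_type, Real.negMulLog_mul, Finset.sum_add_distrib,
      ← Finset.sum_mul, ← Finset.mul_sum, hW, one_mul]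
  rw [h1, h2]; ring

set_option linter.unusedSectionVars false

variable {𝒳 : Type*} {𝒴 : Type*} [Fintype 𝒳] [DecidableEq 𝒳] [Fintype 𝒴] [DecidableEq 𝒴]

theorem sum_cons {α : Type*} [Fintype α] {n : ℕ} (F : (Fin (n + 1) → α) → ℝ) :
    ∑ x, F x = ∑ a, ∑ x : Fin n → α, F (Fin.cons a x) := by
  rw [← (Fin.consEquiv (fun _ : Fin (n + 1) => α)).sum_comp, Fintype.sum_prod_type]
  rfl

theorem ent_snoc {α : Type*} [Fintype α] {n : ℕ} (F : (Fin (n + 1) → α) → ℝ) :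
    entPMF (fun q : α × (Fin n → α) => F (Fin.snoc q.2 q.1)) = entPMF F :=
  entPMF_equiv (Fin.snocEquiv (fun _ : Fin (n + 1) => α)) F

theorem ent_cons {α : Type*} [Fintype α] {n : ℕ} (F : (Fin (n + 1) → α) → ℝ) :
    entPMF (fun q : α × (Fin n → α) => F (Fin.cons q.1 q.2)) = entPMF F :=
  entPMF_equiv (Fin.consEquiv (fun _ : Fin (n + 1) => α)) F

theorem xPath_cons (π : 𝒳 → ℝ) (P : Matrix 𝒳 𝒳 ℝ) (n : ℕ) (a : 𝒳) (x : Fin n → 𝒳) :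
    xPath π P (n + 1) (Fin.cons a x) = π a * xPath (P a) P n x := by
  cases n with
  | zero => simp [xPath]
  | succ n =>
    unfold xPath
    rw [Fin.prod_univ_succ]
    simp only [Nat.succ_pos, dif_pos, Fin.val_zero, Fin.val_succ]
    have h1 : ∀ (i : ℕ) (h : i + 1 < n + 2), (Fin.cons a x : Fin (n + 2) → 𝒳) ⟨i + 1, h⟩ =
      x ⟨i, by omega⟩ := fun _ _ => rfl
    have h0 : ∀ (h : 0 < n + 2), (Fin.cons a x : Fin (n + 2) → 𝒳) ⟨0, h⟩ = a := fun _ => rfl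
    simp only [h0, h1, Fin.cons_succ, Fin.cons_zero]
    simp

theorem yPath_cons (π : 𝒳 → ℝ) (P : Matrix 𝒳 𝒳 ℝ) (g : 𝒳 → 𝒴) (n : ℕ) (b : 𝒴)
    (y : Fin n → 𝒴) :
    yPath π P g (n + 1) (Fin.cons b y) =
      ∑ a, if g a = b then π a * yPath (P a) P g n y else 0 := by
  unfold yPath
  rw [sum_cons]
  refine Finset.sum_congr rfl fun a _ => ?_
  simp only [Fin.forall_fin_succ, Fin.cons_zero, Fin.cons_succ, xPath_cons, Finset.mul_sum]
  by_cases h : g a = b <;> simp [h]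

theorem xyPath_eq (π : 𝒳 → ℝ) (P : Matrix 𝒳 𝒳 ℝ) (g : 𝒳 → 𝒴) (n : ℕ) (a : 𝒳)
    (y : Fin n → 𝒴) :
    xyPath π P g n a y = π a * yPath (P a) P g n y := by
  unfold xyPath yPath
  rw [sum_cons, Finset.sum_eq_single a]
  · simp only [Fin.cons_zero, Fin.cons_succ, xPath_cons, Finset.mul_sum]
    simp
  · intro b _ hb
    simp [hb]
  · simp

theorem yPath_id (π : 𝒳 → ℝ) (P : Matrix 𝒳 𝒳 ℝ) (n : ℕ) (x : Fin n → 𝒳) :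
    yPath π P id n x = xPath π P n x := by
  unfold yPath
  simp [← funext_iff]

theorem yPath_zero (π : 𝒳 → ℝ) (P : Matrix 𝒳 𝒳 ℝ) (g : 𝒳 → 𝒴) (y : Fin 0 → 𝒴) :
    yPath π P g 0 y = 1 := by
  simp [yPath, xPath]

theorem yPath_nonneg (π : 𝒳 → ℝ) (P : Matrix 𝒳 𝒳 ℝ) (g : 𝒳 → 𝒴) (n : ℕ) (y : Fin n → 𝒴)
    (hP0 : ∀ i j, 0 ≤ P i j) (hπ : ∀ x, 0 ≤ π x) : 0 ≤ yPath π P g n y := by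
  refine Finset.sum_nonneg fun x _ => ?_
  split_ifs
  · unfold xPath
    refine mul_nonneg ?_ (Finset.prod_nonneg fun i _ => ?_)
    · split_ifs <;> simp [hπ]
    · split_ifs <;> simp [hP0]
  · exact le_rfl

theorem yPath_total (P : Matrix 𝒳 𝒳 ℝ) (hP1 : ∀ i, ∑ j : 𝒳, P i j = 1) (g : 𝒳 → 𝒴) (n : ℕ) :
    ∀ (π : 𝒳 → ℝ) (_ : ∑ x, π x = 1), ∑ y, yPath π P g n y = 1 := by
  induction n with
  | zero => intro π h; simp [yPath_zero]
  | succ n ih =>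
    intro π h
    rw [sum_cons]
    simp only [yPath_cons]
    have : ∀ b : 𝒴, ∑ y : Fin n → 𝒴, ∑ a, (if g a = b then π a * yPath (P a) P g n y else 0) =
        ∑ a, if g a = b then π a else 0 := by
      intro b
      rw [Finset.sum_comm]
      refine Finset.sum_congr rfl fun a _ => ?_
      split_ifs
      · rw [← Finset.mul_sum, ih _ (hP1 a), mul_one]
      · simp
    simp only [this]
    rw [Finset.sum_comm]
    simpa using h

theorem yPath_sum_snoc (P : Matrix 𝒳 𝒳 ℝ) (hP1 : ∀ i, ∑ j : 𝒳, P i j = 1) (g : 𝒳 → 𝒴) (n : ℕ) :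
    ∀ (π : 𝒳 → ℝ) (_ : ∑ x, π x = 1) (y : Fin n → 𝒴),
      ∑ b, yPath π P g (n + 1) (Fin.snoc y b) = yPath π P g n y := by
  induction n with
  | zero =>
    intro π h y
    have := yPath_total P hP1 g 1 π h
    rw [yPath_zero, ← this, ← (Fin.snocEquiv (fun _ : Fin 1 => 𝒴)).sum_comp,
      Fintype.sum_prod_type]
    refine Finset.sum_congr rfl fun b _ => ?_
    rw [Fintype.sum_unique]
    change yPath π P g 1 (Fin.snoc y b) = yPath π P g 1 (Fin.snoc default b)
    rw [Subsingleton.elim y default]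
  | succ n ih =>
    intro π h y
    obtain ⟨c, z, rfl⟩ : ∃ c z, y = Fin.cons c z := ⟨y 0, Fin.tail y, (Fin.cons_self_tail y).symm⟩
    simp only [← Fin.cons_snoc_eq_snoc_cons, yPath_cons]
    rw [Finset.sum_comm]
    refine Finset.sum_congr rfl fun a _ => ?_
    split_ifs
    · rw [← Finset.mul_sum, ih _ (hP1 a)]
    · simp

theorem yPath_stat (P : Matrix 𝒳 𝒳 ℝ) (μ : 𝒳 → ℝ) (hμ1 : ∑ x : 𝒳, μ x = 1)
    (hμ2 : ∀ j, ∑ i : 𝒳, μ i * P i j = μ j) (g : 𝒳 → 𝒴) (n : ℕ) (y : Fin n → 𝒴) :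
    ∑ a, μ a * yPath (P a) P g n y = yPath μ P g n y := by
  cases n with
  | zero => simpa [yPath_zero] using hμ1
  | succ n =>
    obtain ⟨c, z, rfl⟩ : ∃ c z, y = Fin.cons c z := ⟨y 0, Fin.tail y, (Fin.cons_self_tail y).symm⟩
    simp only [yPath_cons, Finset.mul_sum]
    rw [Finset.sum_comm]
    refine Finset.sum_congr rfl fun b _ => ?_
    split_ifs
    · rw [← hμ2 b, Finset.sum_mul]
      exact Finset.sum_congr rfl fun a _ => by ring
    · simp

theorem yPath_sum_cons (P : Matrix 𝒳 𝒳 ℝ) (μ : 𝒳 → ℝ) (hμ1 : ∑ x : 𝒳, μ x = 1)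
    (hμ2 : ∀ j, ∑ i : 𝒳, μ i * P i j = μ j) (g : 𝒳 → 𝒴) (n : ℕ) (y : Fin n → 𝒴) :
    ∑ b, yPath μ P g (n + 1) (Fin.cons b y) = yPath μ P g n y := by
  simp only [yPath_cons]
  rw [Finset.sum_comm, ← yPath_stat P μ hμ1 hμ2]
  simp

/-- law of `Y_1` -/
noncomputable def law1 (μ : 𝒳 → ℝ) (g : 𝒳 → 𝒴) (b : 𝒴) : ℝ := ∑ a, if g a = b then μ a else 0

theorem yPath_marg (P : Matrix 𝒳 𝒳 ℝ) (μ : 𝒳 → ℝ) (hμ1 : ∑ x : 𝒳, μ x = 1)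
    (hμ2 : ∀ j, ∑ i : 𝒳, μ i * P i j = μ j) (g : 𝒳 → 𝒴) (n : ℕ) (b : 𝒴) :
    ∑ y : Fin n → 𝒴, yPath μ P g (n + 1) (Fin.snoc y b) = law1 μ g b := by
  induction n with
  | zero =>
    rw [Fintype.sum_unique]
    have : (Fin.snoc (default : Fin 0 → 𝒴) b : Fin 1 → 𝒴) = Fin.cons b default := by
      funext i
      have hi : i = 0 := Fin.ext (by have := i.isLt; simp)
      subst hi
      simp [Fin.snoc]
    rw [this, yPath_cons]
    simp [yPath_zero, law1]
  | succ n ih =>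
    rw [sum_cons, Finset.sum_comm, ← ih]
    refine Finset.sum_congr rfl fun y _ => ?_
    simp only [← Fin.cons_snoc_eq_snoc_cons]
    exact yPath_sum_cons P μ hμ1 hμ2 g (n + 1) _

theorem mutInf_y (P : Matrix 𝒳 𝒳 ℝ) (hP1 : ∀ i, ∑ j : 𝒳, P i j = 1)
    (μ : 𝒳 → ℝ) (hμ1 : ∑ x : 𝒳, μ x = 1)
    (hμ2 : ∀ j, ∑ i : 𝒳, μ i * P i j = μ j) (g : 𝒳 → 𝒴) (n : ℕ) :
    mutInfPMF (fun q : 𝒴 × (Fin n → 𝒴) => yPath μ P g (n + 1) (Fin.snoc q.2 q.1)) =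
      entPMF (law1 μ g) + entPMF (yPath μ P g n) - entPMF (yPath μ P g (n + 1)) := by
  have h1 : margFst (fun q : 𝒴 × (Fin n → 𝒴) => yPath μ P g (n + 1) (Fin.snoc q.2 q.1)) =
      law1 μ g := funext fun b => yPath_marg P μ hμ1 hμ2 g n b
  have h2 : margSnd (fun q : 𝒴 × (Fin n → 𝒴) => yPath μ P g (n + 1) (Fin.snoc q.2 q.1)) =
      yPath μ P g n := funext fun b => yPath_sum_snoc P hP1 g n μ hμ1 b
  unfold mutInfPMF
  rw [h1, h2, ent_snoc]

theorem condEnt_y (P : Matrix 𝒳 𝒳 ℝ) (hP1 : ∀ i, ∑ j : 𝒳, P i j = 1)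
    (μ : 𝒳 → ℝ) (hμ1 : ∑ x : 𝒳, μ x = 1) (g : 𝒳 → 𝒴) (n : ℕ) :
    condEntPMF (fun q : 𝒴 × (Fin n → 𝒴) => yPath μ P g (n + 1) (Fin.snoc q.2 q.1)) =
      entPMF (yPath μ P g (n + 1)) - entPMF (yPath μ P g n) := by
  have h2 : margSnd (fun q : 𝒴 × (Fin n → 𝒴) => yPath μ P g (n + 1) (Fin.snoc q.2 q.1)) =
      yPath μ P g n := funext fun b => yPath_sum_snoc P hP1 g n μ hμ1 b
  unfold condEntPMF
  rw [h2, ent_snoc]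

/-- Entropy of `(X_1, Y_2, ..., Y_{m+1})`. -/
noncomputable def HXY (μ : 𝒳 → ℝ) (P : Matrix 𝒳 𝒳 ℝ) (g : 𝒳 → 𝒴) (m : ℕ) : ℝ :=
  entPMF (fun q : 𝒳 × (Fin m → 𝒴) => μ q.1 * yPath (P q.1) P g m q.2)

/-- Reindexing `(last, (a, init))` as `(a, snoc init last)`. -/
theorem ent_snoc2 {δ α : Type*} [Fintype δ] [Fintype α] {n : ℕ}
    (F : δ × (Fin (n + 1) → α) → ℝ) :
    entPMF (fun q : α × (δ × (Fin n → α)) => F (q.2.1, Fin.snoc q.2.2 q.1)) = entPMF F := by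
  simp only [entPMF, Fintype.sum_prod_type]
  rw [Finset.sum_comm]
  refine Finset.sum_congr rfl fun d _ => ?_
  have := ent_snoc (fun y => F (d, y))
  simpa only [entPMF, Fintype.sum_prod_type] using this

theorem condEnt_xy (P : Matrix 𝒳 𝒳 ℝ) (hP1 : ∀ i, ∑ j : 𝒳, P i j = 1)
    (μ : 𝒳 → ℝ) (g : 𝒳 → 𝒴) (n : ℕ) :
    condEntPMF (fun q : 𝒴 × (𝒳 × (Fin n → 𝒴)) =>
        μ q.2.1 * yPath (P q.2.1) P g (n + 1) (Fin.snoc q.2.2 q.1)) =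
      HXY μ P g (n + 1) - HXY μ P g n := by
  unfold condEntPMF HXY
  congr 1
  · exact ent_snoc2 (fun q : 𝒳 × (Fin (n + 1) → 𝒴) => μ q.1 * yPath (P q.1) P g (n + 1) q.2)
  · congr 1
    funext q
    simp only [margSnd]
    rw [← Finset.mul_sum, yPath_sum_snoc P hP1 g n _ (hP1 _)]

theorem lumpCost_eq (P : Matrix 𝒳 𝒳 ℝ) (hP1 : ∀ i, ∑ j : 𝒳, P i j = 1)
    (μ : 𝒳 → ℝ) (hμ1 : ∑ x : 𝒳, μ x = 1) (g : 𝒳 → 𝒴) (k : ℕ) :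
    lumpCost μ P g k = (entPMF (yPath μ P g (k + 2)) - entPMF (yPath μ P g (k + 1))) -
      (HXY μ P g (k + 1) - HXY μ P g k) := by
  unfold lumpCost
  rw [condEnt_y P hP1 μ hμ1 g (k + 1), ← condEnt_xy P hP1 μ g k]
  simp only [xyPath_eq]

theorem sum_ite_cons {n : ℕ} (c : 𝒴) (z : Fin (n + 1) → 𝒴) (F : (Fin n → 𝒴) → ℝ) :
    (∑ y : Fin n → 𝒴, if (Fin.cons c y : Fin (n + 1) → 𝒴) = z then F y else 0) =
      if c = z 0 then F (Fin.tail z) else 0 := by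
  obtain ⟨d, w, rfl⟩ : ∃ d w, z = Fin.cons d w := ⟨z 0, Fin.tail z, (Fin.cons_self_tail z).symm⟩
  simp only [Fin.cons_inj, Fin.cons_zero, Fin.tail_cons]
  by_cases h : c = d <;> simp [h]

/-- (B) -/
theorem hY_concave (P : Matrix 𝒳 𝒳 ℝ) (hP0 : ∀ i j, 0 ≤ P i j) (hP1 : ∀ i, ∑ j : 𝒳, P i j = 1)
    (μ : 𝒳 → ℝ) (hμ0 : ∀ x, 0 ≤ μ x) (hμ1 : ∑ x : 𝒳, μ x = 1)
    (hμ2 : ∀ j, ∑ i : 𝒳, μ i * P i j = μ j) (g : 𝒳 → 𝒴) (n : ℕ) :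
    entPMF (yPath μ P g (n + 2)) - entPMF (yPath μ P g (n + 1)) ≤
      entPMF (yPath μ P g (n + 1)) - entPMF (yPath μ P g n) := by
  rw [← condEnt_y P hP1 μ hμ1 g (n + 1), ← condEnt_y P hP1 μ hμ1 g n]
  refine condEnt_le _ (fun a b => yPath_nonneg _ _ _ _ _ hP0 hμ0) Fin.tail _ ?_
  intro a c
  rw [sum_cons]
  simp only [Fin.tail_cons, ← Fin.cons_snoc_eq_snoc_cons]
  simp only [Finset.sum_ite_eq', Finset.mem_univ, if_true]
  exact (yPath_sum_cons P μ hμ1 hμ2 g (n + 1) _).symm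

/-- (E) -/
theorem lump_nonneg (P : Matrix 𝒳 𝒳 ℝ) (hP0 : ∀ i j, 0 ≤ P i j) (hP1 : ∀ i, ∑ j : 𝒳, P i j = 1)
    (μ : 𝒳 → ℝ) (hμ0 : ∀ x, 0 ≤ μ x) (hμ1 : ∑ x : 𝒳, μ x = 1) (g : 𝒳 → 𝒴) (k : ℕ) :
    HXY μ P g (k + 1) - HXY μ P g k ≤
      entPMF (yPath μ P g (k + 2)) - entPMF (yPath μ P g (k + 1)) := by
  rw [← condEnt_y P hP1 μ hμ1 g (k + 1), ← condEnt_xy P hP1 μ g k]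
  refine condEnt_le _ (fun a b => mul_nonneg (hμ0 _) (yPath_nonneg _ _ _ _ _ hP0 (hP0 _)))
    (fun t : 𝒳 × (Fin k → 𝒴) => Fin.cons (g t.1) t.2) _ ?_
  intro a c
  simp only [Fintype.sum_prod_type, sum_ite_cons]
  conv_lhs => rw [← Fin.cons_self_tail c]
  rw [← Fin.cons_snoc_eq_snoc_cons, yPath_cons]

/-- (D) -/
theorem hXY_mono (P : Matrix 𝒳 𝒳 ℝ) (hP0 : ∀ i j, 0 ≤ P i j) (hP1 : ∀ i, ∑ j : 𝒳, P i j = 1)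
    (μ : 𝒳 → ℝ) (hμ0 : ∀ x, 0 ≤ μ x)
    (hμ2 : ∀ j, ∑ i : 𝒳, μ i * P i j = μ j) (g : 𝒳 → 𝒴) (k : ℕ) :
    HXY μ P g (k + 1) - HXY μ P g k ≤ HXY μ P g (k + 2) - HXY μ P g (k + 1) := by
  rw [← condEnt_xy P hP1 μ g (k + 1)]
  have hm : ∀ m, entPMF (fun t : 𝒳 × 𝒳 × (Fin m → 𝒴) =>
      μ t.1 * P t.1 t.2.1 * yPath (P t.2.1) P g m t.2.2) + entPMF μ =
      entPMF (fun t : 𝒳 × 𝒳 => μ t.1 * P t.1 t.2) + HXY μ P g m := fun m =>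
    ent_markov (fun t : 𝒳 × 𝒳 => μ t.1 * P t.1 t.2) (fun b c => yPath (P b) P g m c) μ hμ2
      (fun b => yPath_total P hP1 g m _ (hP1 b))
  have hc : condEntPMF (fun q : 𝒴 × (𝒳 × 𝒳 × (Fin k → 𝒴)) =>
      μ q.2.1 * P q.2.1 q.2.2.1 * yPath (P q.2.2.1) P g (k + 1) (Fin.snoc q.2.2.2 q.1)) =
      HXY μ P g (k + 1) - HXY μ P g k := by
    have h1 : entPMF (fun q : 𝒴 × (𝒳 × 𝒳 × (Fin k → 𝒴)) =>
        μ q.2.1 * P q.2.1 q.2.2.1 * yPath (P q.2.2.1) P g (k + 1) (Fin.snoc q.2.2.2 q.1)) =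
        entPMF (fun t : 𝒳 × 𝒳 × (Fin (k + 1) → 𝒴) =>
          μ t.1 * P t.1 t.2.1 * yPath (P t.2.1) P g (k + 1) t.2.2) := by
      have := ent_snoc2 (fun t : (𝒳 × 𝒳) × (Fin (k + 1) → 𝒴) =>
          μ t.1.1 * P t.1.1 t.1.2 * yPath (P t.1.2) P g (k + 1) t.2)
      simpa only [entPMF, Fintype.sum_prod_type] using this
    have h2 : margSnd (fun q : 𝒴 × (𝒳 × 𝒳 × (Fin k → 𝒴)) =>
        μ q.2.1 * P q.2.1 q.2.2.1 * yPath (P q.2.2.1) P g (k + 1) (Fin.snoc q.2.2.2 q.1)) =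
        (fun t : 𝒳 × 𝒳 × (Fin k → 𝒴) =>
          μ t.1 * P t.1 t.2.1 * yPath (P t.2.1) P g k t.2.2) := by
      funext q
      simp only [margSnd]
      rw [← Finset.mul_sum, yPath_sum_snoc P hP1 g k _ (hP1 _)]
    unfold condEntPMF
    rw [h1, h2]
    linarith [hm k, hm (k + 1)]
  rw [← hc]
  refine condEnt_le _ (fun a b => mul_nonneg (mul_nonneg (hμ0 _) (hP0 _ _))
      (yPath_nonneg _ _ _ _ _ hP0 (hP0 _)))
    (fun t : 𝒳 × 𝒳 × (Fin k → 𝒴) => (t.1, (Fin.cons (g t.2.1) t.2.2 : Fin (k + 1) → 𝒴))) _ ?_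
  rintro a ⟨x, c⟩
  simp only [Fintype.sum_prod_type, Prod.mk.injEq]
  rw [Finset.sum_eq_single x]
  · simp only [true_and, sum_ite_cons]
    conv_lhs => rw [← Fin.cons_self_tail c]
    rw [← Fin.cons_snoc_eq_snoc_cons, yPath_cons, Finset.mul_sum]
    refine Finset.sum_congr rfl fun b _ => ?_
    split_ifs
    · ring
    · simp
  · intro b _ hb
    simp [hb]
  · simp

/-- law of `(Y_1, X_2)` -/
noncomputable def lawYX (μ : 𝒳 → ℝ) (P : Matrix 𝒳 𝒳 ℝ) (g : 𝒳 → 𝒴) (t : 𝒴 × 𝒳) : ℝ :=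
  ∑ a, if g a = t.1 then μ a * P a t.2 else 0

theorem lawYX_sum (P : Matrix 𝒳 𝒳 ℝ) (μ : 𝒳 → ℝ)
    (hμ2 : ∀ j, ∑ i : 𝒳, μ i * P i j = μ j) (g : 𝒳 → 𝒴) (x : 𝒳) :
    ∑ b, lawYX μ P g (b, x) = μ x := by
  unfold lawYX
  rw [Finset.sum_comm, ← hμ2]
  simp

/-- (F1) -/
theorem hY_lower (P : Matrix 𝒳 𝒳 ℝ) (hP0 : ∀ i j, 0 ≤ P i j) (hP1 : ∀ i, ∑ j : 𝒳, P i j = 1)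
    (μ : 𝒳 → ℝ) (hμ0 : ∀ x, 0 ≤ μ x) (hμ1 : ∑ x : 𝒳, μ x = 1)
    (hμ2 : ∀ j, ∑ i : 𝒳, μ i * P i j = μ j) (g : 𝒳 → 𝒴) (n : ℕ) :
    entPMF (lawYX μ P g) - entPMF μ ≤
      entPMF (yPath μ P g (n + 2)) - entPMF (yPath μ P g (n + 1)) := by
  have hm : entPMF (fun t : 𝒴 × 𝒳 × (Fin n → 𝒴) =>
      lawYX μ P g (t.1, t.2.1) * yPath (P t.2.1) P g n t.2.2) + entPMF μ =
      entPMF (lawYX μ P g) + HXY μ P g n :=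
    ent_markov (lawYX μ P g) (fun b c => yPath (P b) P g n c) μ (lawYX_sum P μ hμ2 g)
      (fun b => yPath_total P hP1 g n _ (hP1 b))
  have h1 : condEntPMF (fun t : 𝒴 × 𝒳 × (Fin n → 𝒴) =>
      lawYX μ P g (t.1, t.2.1) * yPath (P t.2.1) P g n t.2.2) =
      entPMF (lawYX μ P g) - entPMF μ := by
    have : margSnd (fun t : 𝒴 × 𝒳 × (Fin n → 𝒴) =>
      lawYX μ P g (t.1, t.2.1) * yPath (P t.2.1) P g n t.2.2) =
      fun q : 𝒳 × (Fin n → 𝒴) => μ q.1 * yPath (P q.1) P g n q.2 := by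
      funext q
      simp only [margSnd]
      rw [← Finset.sum_mul, lawYX_sum P μ hμ2 g]
    unfold condEntPMF
    rw [this]
    unfold HXY at hm
    linarith
  have h2 : condEntPMF (fun t : 𝒴 × (Fin (n + 1) → 𝒴) => yPath μ P g (n + 2) (Fin.cons t.1 t.2)) =
      entPMF (yPath μ P g (n + 2)) - entPMF (yPath μ P g (n + 1)) := by
    have : margSnd (fun t : 𝒴 × (Fin (n + 1) → 𝒴) => yPath μ P g (n + 2) (Fin.cons t.1 t.2)) =
      yPath μ P g (n + 1) := funext fun y => yPath_sum_cons P μ hμ1 hμ2 g (n + 1) y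
    unfold condEntPMF
    rw [this, ent_cons]
  rw [← h1, ← h2]
  refine condEnt_le _ (fun a b => mul_nonneg (Finset.sum_nonneg fun x _ => ?_)
      (yPath_nonneg _ _ _ _ _ hP0 (hP0 _)))
    (fun t : 𝒳 × (Fin n → 𝒴) => (Fin.cons (g t.1) t.2 : Fin (n + 1) → 𝒴)) _ ?_
  · split_ifs
    · exact mul_nonneg (hμ0 _) (hP0 _ _)
    · exact le_rfl
  · intro a c
    simp only [Fintype.sum_prod_type, sum_ite_cons]
    conv_lhs => rw [← Fin.cons_self_tail c]
    simp only [yPath_cons, lawYX]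
    simp only [Finset.sum_mul, Finset.mul_sum]
    have : ∀ x : 𝒳, (if g x = c 0 then ∑ i, (if g i = a then μ i * P i x else 0) *
        yPath (P x) P g n (Fin.tail c) else 0) = ∑ i, if g x = c 0 then
          (if g i = a then μ i * P i x else 0) * yPath (P x) P g n (Fin.tail c) else 0 := by
      intro x; split_ifs <;> simp
    simp only [this]
    rw [Finset.sum_comm]
    refine Finset.sum_congr rfl fun i _ => ?_
    by_cases h : g i = a
    · simp only [h, if_true]
      refine Finset.sum_congr rfl fun x _ => ?_
      split_ifs
      · ring
      · simp
    · simp [h]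

/-- (F2) -/
theorem submod2 (P : Matrix 𝒳 𝒳 ℝ) (hP0 : ∀ i j, 0 ≤ P i j)
    (μ : 𝒳 → ℝ) (hμ0 : ∀ x, 0 ≤ μ x) (g : 𝒳 → 𝒴) :
    entPMF (fun t : 𝒳 × 𝒳 => μ t.1 * P t.1 t.2) - entPMF (lawYX μ P g) ≤
      HXY μ P g 1 - entPMF (yPath μ P g 2) := by
  have h1 : condEntPMF (fun t : 𝒳 × (𝒴 × 𝒳) => if g t.1 = t.2.1 then μ t.1 * P t.1 t.2.2 else 0) =
      entPMF (fun t : 𝒳 × 𝒳 => μ t.1 * P t.1 t.2) - entPMF (lawYX μ P g) := by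
    unfold condEntPMF
    congr 1
    simp only [entPMF, Fintype.sum_prod_type]
    refine Finset.sum_congr rfl fun x _ => ?_
    rw [Finset.sum_comm]
    simp only [apply_ite Real.negMulLog, Real.negMulLog_zero]
    simp
  have h2 : condEntPMF (fun t : 𝒳 × (𝒴 × (Fin 1 → 𝒴)) =>
      if g t.1 = t.2.1 then μ t.1 * yPath (P t.1) P g 1 t.2.2 else 0) =
      HXY μ P g 1 - entPMF (yPath μ P g 2) := by
    unfold condEntPMF HXY
    congr 1
    · simp only [entPMF, Fintype.sum_prod_type]
      refine Finset.sum_congr rfl fun x _ => ?_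
      rw [Finset.sum_comm]
      simp only [apply_ite Real.negMulLog, Real.negMulLog_zero]
      simp
    · rw [← ent_cons]
      congr 1
      funext t
      rw [yPath_cons]
      rfl
  rw [← h1, ← h2]
  refine condEnt_le _ (fun a b => ?_)
    (fun t : 𝒴 × 𝒳 => (t.1, (Fin.cons (g t.2) default : Fin 1 → 𝒴))) _ ?_
  · dsimp only
    split_ifs
    · exact mul_nonneg (hμ0 _) (hP0 _ _)
    · exact le_rfl
  · rintro a ⟨b, c⟩
    obtain ⟨d, w, rfl⟩ : ∃ d w, c = Fin.cons d w := ⟨c 0, Fin.tail c, (Fin.cons_self_tail c).symm⟩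
    have hw : w = default := Subsingleton.elim _ _
    subst hw
    simp only [Fintype.sum_prod_type, Prod.mk.injEq, Fin.cons_inj, and_true, yPath_cons, yPath_zero,
      mul_one]
    rw [Finset.sum_eq_single b]
    · by_cases h : g a = b
      · simp only [h, if_true, true_and, Finset.mul_sum]
        refine Finset.sum_congr rfl fun x _ => ?_
        split_ifs <;> simp
      · simp [h]
    · intro b' _ hb
      simp [hb]
    · simp

theorem hX_step (P : Matrix 𝒳 𝒳 ℝ) (hP1 : ∀ i, ∑ j : 𝒳, P i j = 1)
    (μ : 𝒳 → ℝ) (hμ2 : ∀ j, ∑ i : 𝒳, μ i * P i j = μ j) (n : ℕ) :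
    entPMF (yPath μ P (id : 𝒳 → 𝒳) (n + 2)) + entPMF μ =
      entPMF (fun t : 𝒳 × 𝒳 => μ t.1 * P t.1 t.2) + entPMF (yPath μ P (id : 𝒳 → 𝒳) (n + 1)) := by
  have hm := ent_markov (fun t : 𝒳 × 𝒳 => μ t.1 * P t.1 t.2)
    (fun b c => yPath (P b) P (id : 𝒳 → 𝒳) n c) μ hμ2
      (fun b => yPath_total P hP1 id n _ (hP1 b))
  have hc : ∀ (π : 𝒳 → ℝ) (m : ℕ) (a : 𝒳) (x : Fin m → 𝒳),
      yPath π P (id : 𝒳 → 𝒳) (m + 1) (Fin.cons a x) = π a * yPath (P a) P id m x := by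
    intro π m a x
    rw [yPath_cons]
    simp
  have h1 : entPMF (yPath μ P (id : 𝒳 → 𝒳) (n + 1)) =
      entPMF (fun t : 𝒳 × (Fin n → 𝒳) => μ t.1 * yPath (P t.1) P id n t.2) := by
    rw [← ent_cons]
    simp only [hc]
  have h2 : entPMF (yPath μ P (id : 𝒳 → 𝒳) (n + 2)) =
      entPMF (fun t : 𝒳 × 𝒳 × (Fin n → 𝒳) =>
        μ t.1 * P t.1 t.2.1 * yPath (P t.2.1) P id n t.2.2) := by
    rw [← ent_cons]
    simp only [entPMF, Fintype.sum_prod_type]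
    refine Finset.sum_congr rfl fun a _ => ?_
    rw [sum_cons]
    simp only [hc, mul_assoc]
  rw [h1, h2]
  exact hm

end Helpers

/-- Δ_P^∞(X,g) = lim_k Δ_P^k(X,g) = R̄(X) − R̄(Y) ≥ Δ_L^1(X,g), and the cost
functions form an ordered chain
Δ_P^1 ≥ Δ_P^2 ≥ ⋯ ≥ Δ_P^∞ ≥ Δ_L^1 ≥ Δ_L^2 ≥ ⋯ ≥ 0.
(Here `predCost μ P g k` is Δ_P^{k+1} and `lumpCost μ P g k` is Δ_L^{k+1}.) -/
theorem stmt13 {𝒳 𝒴 : Type*} [Fintype 𝒳] [DecidableEq 𝒳] [Fintype 𝒴] [DecidableEq 𝒴]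
    (P : Matrix 𝒳 𝒳 ℝ) (hP0 : ∀ i j, 0 ≤ P i j) (hP1 : ∀ i, ∑ j : 𝒳, P i j = 1)
    (hprim : PrimitiveMatrix P)
    (μ : 𝒳 → ℝ) (hμ0 : ∀ x, 0 ≤ μ x) (hμ1 : ∑ x : 𝒳, μ x = 1)
    (hμ2 : ∀ j, ∑ i : 𝒳, μ i * P i j = μ j) (g : 𝒳 → 𝒴) (rX rY : ℝ)
    (hrX : Tendsto (fun n : ℕ =>
        mutInfPMF (fun q : 𝒳 × (Fin n → 𝒳) => xPath μ P (n + 1) (Fin.snoc q.2 q.1)))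
      atTop (nhds rX))
    (hrY : Tendsto (fun n : ℕ =>
        mutInfPMF (fun q : 𝒴 × (Fin n → 𝒴) => yPath μ P g (n + 1) (Fin.snoc q.2 q.1)))
      atTop (nhds rY)) :
    Tendsto (fun k : ℕ => predCost μ P g k) atTop (nhds (rX - rY)) ∧
    lumpCost μ P g 0 ≤ rX - rY ∧
    (∀ k : ℕ, predCost μ P g (k + 1) ≤ predCost μ P g k) ∧
    (∀ k : ℕ, rX - rY ≤ predCost μ P g k) ∧
    (∀ k : ℕ, lumpCost μ P g (k + 1) ≤ lumpCost μ P g k) ∧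
    (∀ k : ℕ, 0 ≤ lumpCost μ P g k) := by
  have hI : mutInfPMF (fun q : 𝒳 × 𝒳 => μ q.1 * P q.1 q.2) =
      entPMF μ + entPMF μ - entPMF (fun t : 𝒳 × 𝒳 => μ t.1 * P t.1 t.2) := by
    have h1 : margFst (fun q : 𝒳 × 𝒳 => μ q.1 * P q.1 q.2) = μ := by
      funext a
      simp only [margFst]
      rw [← Finset.mul_sum, hP1, mul_one]
    have h2 : margSnd (fun q : 𝒳 × 𝒳 => μ q.1 * P q.1 q.2) = μ := funext hμ2
    unfold mutInfPMF
    rw [h1, h2]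
  have hlawid : law1 μ (id : 𝒳 → 𝒳) = μ := by
    funext a
    simp [law1]
  have hX : rX = mutInfPMF (fun q : 𝒳 × 𝒳 => μ q.1 * P q.1 q.2) := by
    refine tendsto_nhds_unique ((tendsto_add_atTop_iff_nat 1).2 hrX) ?_
    refine tendsto_const_nhds.congr fun n => ?_
    have h := mutInf_y P hP1 μ hμ1 hμ2 (id : 𝒳 → 𝒳) (n + 1)
    simp only [yPath_id] at h
    rw [h, hI, hlawid, eq_comm]
    have h2 := hX_step P hP1 μ hμ2 n
    have e : ∀ m, yPath μ P (id : 𝒳 → 𝒳) m = xPath μ P m := fun m => funext (yPath_id μ P m)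
    simp only [e] at h2 ⊢
    linarith
  have hpred : ∀ k, predCost μ P g k = rX - (entPMF (law1 μ g) + entPMF (yPath μ P g (k + 1)) -
      entPMF (yPath μ P g (k + 2))) := by
    intro k
    unfold predCost
    rw [← hX, mutInf_y P hP1 μ hμ1 hμ2 g (k + 1)]
  have hT : Tendsto (fun k : ℕ => predCost μ P g k) atTop (nhds (rX - rY)) := by
    have := ((tendsto_add_atTop_iff_nat 1).2 hrY).const_sub rX
    refine this.congr fun k => ?_
    rw [hpred, mutInf_y P hP1 μ hμ1 hμ2 g (k + 1)]
  have hmono : ∀ k : ℕ, predCost μ P g (k + 1) ≤ predCost μ P g k := by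
    intro k
    rw [hpred, hpred]
    linarith [hY_concave P hP0 hP1 μ hμ0 hμ1 hμ2 g (k + 1)]
  have hH1 : entPMF (yPath μ P g 1) = entPMF (law1 μ g) := by
    have h := mutInf_y P hP1 μ hμ1 hμ2 g 0
    rw [← ent_cons]
    simp only [yPath_cons, yPath_zero, mul_one, entPMF, Fintype.sum_prod_type]
    simp [law1]
  have hXY0 : HXY μ P g 0 = entPMF μ := by
    unfold HXY
    simp [yPath_zero, entPMF, Fintype.sum_prod_type]
  refine ⟨hT, ?_, hmono, ?_, ?_, ?_⟩
  · refine ge_of_tendsto' hT fun n => ?_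
    rw [hpred, lumpCost_eq P hP1 μ hμ1, hX, hI, hXY0]
    have h1 := hY_lower P hP0 hP1 μ hμ0 hμ1 hμ2 g n
    have h2 := submod2 P hP0 μ hμ0 g
    simp only [zero_add] at *
    linarith
  · exact fun k => (antitone_nat_of_succ_le hmono).le_of_tendsto hT k
  · intro k
    rw [lumpCost_eq P hP1 μ hμ1, lumpCost_eq P hP1 μ hμ1]
    linarith [hY_concave P hP0 hP1 μ hμ0 hμ1 hμ2 g (k + 1), hXY_mono P hP0 hP1 μ hμ0 hμ2 g k]
  · intro k
    rw [lumpCost_eq P hP1 μ hμ1]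
    linarith [lump_nonneg P hP0 hP1 μ hμ0 hμ1 g k]
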